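/- Let S be a semigroup which is not completely separable, and let T be a semigroup generated by a single element x such that x^i ≠ x^j for all i ∈ {1,2,3} and all j > i (i.e. T is monogenic of index at least 4, possibly infinite). Then the direct product S × T is not strongly subsemigroup separable. -/

import Mathlib

/-- `s` can be separated from `Y` in `S`: there is a homomorphism to a finite
semigroup mapping `s` outside the image of `Y`. -/
def Separates {S : Type*} [Semigroup S] (s : S) (Y : Set S) : Prop :=
  ∃ (P : Type) (_ : Semigroup P) (_ : Finite P) (φ : S →ₙ* P), φ s ∉ φ '' Y

/-- Complete separability. -/
def IsCS (S : Type*) [Semigroup S] : Prop :=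
  ∀ (s : S) (Y : Set S), s ∉ Y → Separates s Y

/-- Strong subsemigroup separability. -/
def IsSSS (S : Type*) [Semigroup S] : Prop :=
  ∀ (s : S) (Y : Subsemigroup S), s ∉ Y → Separates s (Y : Set S)

/-- Weak subsemigroup separability. -/
def IsWSS (S : Type*) [Semigroup S] : Prop :=
  ∀ (s : S) (X : Finset S), s ∉ Subsemigroup.closure (X : Set S) →
    Separates s (Subsemigroup.closure (X : Set S) : Set S)

/-- Monogenic subsemigroup separability. -/
def IsMSS (S : Type*) [Semigroup S] : Prop :=
  ∀ (s x : S), s ∉ Subsemigroup.closure {x} →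
    Separates s (Subsemigroup.closure {x} : Set S)

/-- Residual finiteness. -/
def ResiduallyFinite (S : Type*) [Semigroup S] : Prop :=
  ∀ s t : S, s ≠ t → ∃ (P : Type) (_ : Semigroup P) (_ : Finite P) (φ : S →ₙ* P), φ s ≠ φ t

/-- `spow x n` is the `(n+1)`-st power `x^(n+1)` of `x` in a semigroup. -/
def spow {T : Type*} [Semigroup T] (x : T) : ℕ → T
  | 0 => x
  | n + 1 => spow x n * x

theorem spow_mul_spow {T : Type*} [Semigroup T] (x : T) (i j : ℕ) :
    spow x i * spow x j = spow x (i + j + 1) := by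
  induction j with
  | zero => rfl
  | succ j ih => exact (mul_assoc _ _ _).symm.trans (congrArg (· * x) ih)

/-- The syntactic congruence of the singleton `{s}`. -/
def syntacticCon {S : Type*} [Semigroup S] (s : S) : Con S where
  r a b := ∀ u v : WithOne S, u * a * v = s ↔ u * b * v = s
  iseqv :=
    ⟨fun _ _ _ => Iff.rfl, fun h u v => (h u v).symm, fun h k u v => (h u v).trans (k u v)⟩
  mul' {a b c d} h k u v := by
    have h' := h u (c * v)
    have k' := k (u * b) v
    simp only [WithOne.coe_mul, mul_assoc] at h' k' ⊢
    exact h'.trans k'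

theorem syntacticCon_apply {S : Type*} [Semigroup S] {s a b : S} :
    syntacticCon s a b ↔ ∀ u v : WithOne S, u * a * v = s ↔ u * b * v = s :=
  Iff.rfl

theorem eq_of_syntacticCon {S : Type*} [Semigroup S] {s y : S} (h : syntacticCon s y s) :
    y = s := by
  simpa using syntacticCon_apply.1 h 1 1

/-- Separation by a finite quotient, in any universe. -/
theorem separates_of_finite_quotient {S : Type*} [Semigroup S] {s : S} {Y : Set S} (c : Con S)
    [Finite c.Quotient] (h : ∀ y ∈ Y, ¬ c y s) : Separates s Y := by
  obtain ⟨P, _, ⟨e⟩⟩ : ∃ P : Type, Finite P ∧ Nonempty (c.Quotient ≃ P) :=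
    let ⟨n, he⟩ := Finite.exists_equiv_fin c.Quotient
    ⟨Fin n, inferInstance, he⟩
  let : Semigroup P := e.symm.semigroup
  refine ⟨P, inferInstance, inferInstance,
    (e.symm.mulEquiv.symm : c.Quotient →ₙ* P).comp ⟨fun a => (a : c.Quotient), fun _ _ => rfl⟩,
    ?_⟩
  rintro ⟨y, hy, hys⟩
  exact h y hy ((Con.eq c).1 (e.injective hys))

/-- All pairs whose second component is a power of `x` with exponent at least `3`, except
`(s, x ^ 3)`. -/
def puncturedSubsemigroup {S T : Type*} [Semigroup S] [Semigroup T] (s : S) (x : T)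
    (hx : ∀ j, 2 < j → spow x 2 ≠ spow x j) : Subsemigroup (S × T) where
  carrier := {p | p ≠ (s, spow x 2) ∧ ∃ j, 2 ≤ j ∧ p.2 = spow x j}
  mul_mem' := by
    rintro ⟨a, _⟩ ⟨b, _⟩ ⟨-, i, hi, rfl⟩ ⟨-, j, hj, rfl⟩
    refine ⟨fun h => hx (i + j + 1) (by omega) ?_, i + j + 1, by omega, spow_mul_spow x i j⟩
    rw [← spow_mul_spow]
    exact (congrArg Prod.snd h).symm

/-- A homomorphism on `S × T` isolating `(s, x ^ 3)` in `S × {x ^ 3}` refines the syntactic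
congruence of `s`. -/
theorem eq_of_mul_mul_eq {S T P : Type*} [Semigroup S] [Semigroup T] [Semigroup P] {s : S} {x : T}
    (φ : S × T →ₙ* P) (hφ : ∀ t, φ (t, spow x 2) = φ (s, spow x 2) → t = s) {a b : S}
    (h : ∀ i : Fin 3, φ (a, spow x i) = φ (b, spow x i)) (u v : WithOne S)
    (ha : u * a * v = s) : u * b * v = s := by
  have h₀ : φ (a, spow x 0) = φ (b, spow x 0) := h 0
  have h₁ : φ (a, spow x 1) = φ (b, spow x 1) := h 1
  have h₂ : φ (a, spow x 2) = φ (b, spow x 2) := h 2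
  have two (c d : S) : (c * d, spow x 2) = (c, spow x 0) * (d, spow x 1) := by
    rw [Prod.mk_mul_mk, spow_mul_spow]
  have two' (c d : S) : (c * d, spow x 2) = (c, spow x 1) * (d, spow x 0) := by
    rw [Prod.mk_mul_mk, spow_mul_spow]
  have one (c d : S) : (c * d, spow x 1) = (c, spow x 0) * (d, spow x 0) := by
    rw [Prod.mk_mul_mk, spow_mul_spow]
  induction u with
  | one =>
    induction v with
    | one =>
      simp only [one_mul, mul_one, WithOne.coe_inj] at ha ⊢
      exact hφ _ (by rw [← h₂, ha])
    | coe v =>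
      simp only [one_mul, ← WithOne.coe_mul, WithOne.coe_inj] at ha ⊢
      exact hφ _ (by rw [← ha, two', two', map_mul, map_mul, h₁])
  | coe u =>
    induction v with
    | one =>
      simp only [mul_one, ← WithOne.coe_mul, WithOne.coe_inj] at ha ⊢
      exact hφ _ (by rw [← ha, two, two, map_mul, map_mul, h₁])
    | coe v =>
      simp only [← WithOne.coe_mul, WithOne.coe_inj] at ha ⊢
      exact hφ _ (by rw [← ha, two', two', map_mul, map_mul, one, one, map_mul, map_mul, h₀])

/-- If `S` is not completely separable and `T` is generated by a single element `x`
with `x^i ≠ x^j` whenever `i ∈ {1,2,3}` and `j > i` (i.e. `T` is monogenic of index at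
least `4`), then `S × T` is not strongly subsemigroup separable. -/
theorem stmt_4 (S T : Type*) [Semigroup S] [Semigroup T] (hS : ¬ IsCS S)
    (x : T) (hgen : Subsemigroup.closure {x} = ⊤)
    (hx : ∀ i j : ℕ, i < 3 → i < j → spow x i ≠ spow x j) :
    ¬ IsSSS (S × T) := by
  intro hST
  refine hS fun s Y hsY => ?_
  have hx₂ : ∀ j, 2 < j → spow x 2 ≠ spow x j := fun j => hx 2 j (by omega)
  obtain ⟨P, _, _, φ, hφ⟩ :=
    hST (s, spow x 2) (puncturedSubsemigroup s x hx₂) fun h => h.1 rfl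
  have hφ' : ∀ t, φ (t, spow x 2) = φ (s, spow x 2) → t = s := by
    intro t ht
    by_contra hts
    exact hφ ⟨_, ⟨fun h => hts (congrArg Prod.fst h), 2, le_rfl, rfl⟩, ht⟩
  have : Finite (syntacticCon s).Quotient := by
    refine Finite.of_injective
      (fun q (i : Fin 3) => φ (Quotient.out q, spow x i)) fun q q' h => ?_
    rw [← Quotient.out_eq q, ← Quotient.out_eq q']
    exact Quotient.sound fun u v =>
      ⟨eq_of_mul_mul_eq φ hφ' (congrFun h) u v,
        eq_of_mul_mul_eq φ hφ' (fun i => (congrFun h i).symm) u v⟩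
  exact separates_of_finite_quotient (syntacticCon s) fun y hy h =>
    hsY (eq_of_syntacticCon h ▸ hy)
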